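/- arXiv:2603.16988 — 2 statements merged into one kernel-verified Lean document; each statement's English description precedes it below -/
import Mathlib

section
/- If n ≥ 1 is even and 3 does not divide n, then the n-th root-of-unity ray pool P_n admits a KS coloring. -/
open Complex

noncomputable def zeta (n : ℕ) : ℂ := Complex.exp (2 * Real.pi * Complex.I / n)

noncomputable def hermInner (v w : Fin 3 → ℂ) : ℂ :=
  ∑ k, (starRingEnd ℂ) (v k) * w k

abbrev Ray3 := Projectivization ℂ (Fin 3 → ℂ)

/-- Orthogonality of rays, tested on canonical representatives; this is
independent of the choice of representative since the Hermitian inner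
product scales by nonzero factors. -/
def RayOrtho (x y : Ray3) : Prop := hermInner x.rep y.rep = 0

/-- The n-th root-of-unity ray pool: rays admitting a representative all of
whose coordinates lie in {0} ∪ {ζ^k : 0 ≤ k < n}. -/
def pool (n : ℕ) : Set Ray3 :=
  {x | ∃ (v : Fin 3 → ℂ) (hv : v ≠ 0), Projectivization.mk ℂ v hv = x ∧
    ∀ k, v k = 0 ∨ ∃ j : ℕ, j < n ∧ v k = zeta n ^ j}

/-- A KS coloring of a set `S` of rays: (a) orthogonal exclusion; (b) every
triad contained in `S` has exactly one element colored `true`. -/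
def IsKSColoring (S : Set Ray3) (f : Ray3 → Bool) : Prop :=
  (∀ v ∈ S, ∀ w ∈ S, RayOrtho v w → f v = true → f w = false) ∧
  (∀ a ∈ S, ∀ b ∈ S, ∀ c ∈ S, a ≠ b → a ≠ c → b ≠ c →
    RayOrtho a b → RayOrtho a c → RayOrtho b c →
      ((f a = true ∧ f b = false ∧ f c = false) ∨
       (f a = false ∧ f b = true ∧ f c = false) ∨
       (f a = false ∧ f b = false ∧ f c = true)))

def KSUncolorable (S : Set Ray3) : Prop := ¬ ∃ f : Ray3 → Bool, IsKSColoring S f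

theorem hermInner_eq (v w : Fin 3 → ℂ) : hermInner v w =
    (starRingEnd ℂ) (v 0) * w 0 + (starRingEnd ℂ) (v 1) * w 1 + (starRingEnd ℂ) (v 2) * w 2 := by
  simp [hermInner, Fin.sum_univ_three]

theorem hermInner_symm {v w : Fin 3 → ℂ} (h : hermInner v w = 0) : hermInner w v = 0 := by
  have := congrArg (starRingEnd ℂ) h
  simpa [hermInner, mul_comm] using this

theorem eq_zero_of_conj_mul_add {y₁ y₂ : ℂ}
    (h : (starRingEnd ℂ) y₁ * y₁ + (starRingEnd ℂ) y₂ * y₂ = 0) : y₁ = 0 ∧ y₂ = 0 := by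
  rw [← Complex.normSq_eq_conj_mul_self, ← Complex.normSq_eq_conj_mul_self] at h
  norm_cast at h
  have h₁ := Complex.normSq_nonneg y₁
  have h₂ := Complex.normSq_nonneg y₂
  exact ⟨Complex.normSq_eq_zero.1 (by linarith), Complex.normSq_eq_zero.1 (by linarith)⟩

/-- `ℂ²` contains no three pairwise orthogonal nonzero vectors. -/
theorem not_pairwise_orthogonal_plane {x₁ x₂ y₁ y₂ z₁ z₂ : ℂ}
    (hx : ¬(x₁ = 0 ∧ x₂ = 0)) (hy : ¬(y₁ = 0 ∧ y₂ = 0)) (hz : ¬(z₁ = 0 ∧ z₂ = 0))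
    (hxy : (starRingEnd ℂ) x₁ * y₁ + (starRingEnd ℂ) x₂ * y₂ = 0)
    (hxz : (starRingEnd ℂ) x₁ * z₁ + (starRingEnd ℂ) x₂ * z₂ = 0)
    (hyz : (starRingEnd ℂ) y₁ * z₁ + (starRingEnd ℂ) y₂ * z₂ = 0) : False := by
  have hdet : y₁ * z₂ = y₂ * z₁ := by
    by_cases h₁ : x₁ = 0
    · have h₂ : (starRingEnd ℂ) x₂ ≠ 0 := by
        rw [map_ne_zero]
        exact fun h => hx ⟨h₁, h⟩
      apply mul_left_cancel₀ h₂
      linear_combination y₁ * hxz - z₁ * hxy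
    · apply mul_left_cancel₀ ((map_ne_zero (starRingEnd ℂ)).2 h₁)
      linear_combination z₂ * hxy - y₂ * hxz
  have hy' : (starRingEnd ℂ) y₁ * y₁ + (starRingEnd ℂ) y₂ * y₂ ≠ 0 :=
    fun h => hy (eq_zero_of_conj_mul_add h)
  refine hz ⟨?_, ?_⟩
  · apply (mul_eq_zero.1 ?_).resolve_left hy'
    linear_combination y₁ * hyz - (starRingEnd ℂ) y₂ * hdet
  · apply (mul_eq_zero.1 ?_).resolve_left hy'
    linear_combination y₂ * hyz + (starRingEnd ℂ) y₁ * hdet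

/-- The half-plane that contains exactly one of `z` and `-z` for `z ≠ 0`, together with `0`. -/
def InHalfPlane (z : ℂ) : Prop := 0 < z.re ∨ (z.re = 0 ∧ 0 ≤ z.im)

theorem inHalfPlane_zero : InHalfPlane 0 := by simp [InHalfPlane]

theorem conj_mul_eq_neg_one_iff {t s : ℂ} : (starRingEnd ℂ) t * s = -1 ↔
    t.re * s.re + t.im * s.im = -1 ∧ t.re * s.im = t.im * s.re := by
  simp [Complex.ext_iff]
  grind

theorem not_inHalfPlane_of_conj_mul {t s : ℂ} (h : (starRingEnd ℂ) t * s = -1)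
    (ht : InHalfPlane t) (hs : InHalfPlane s) : False := by
  obtain ⟨h₁, h₂⟩ := conj_mul_eq_neg_one_iff.1 h
  rcases ht with ht | ⟨ht, ht'⟩ <;> rcases hs with hs | ⟨hs, hs'⟩
  · have hre := mul_pos ht hs
    have him : (t.re * s.re) * (t.im * s.im) = (t.re * s.im) ^ 2 := by
      linear_combination -(t.re * s.im) * h₂
    nlinarith [sq_nonneg (t.re * s.im), sq_nonneg (t.re * s.re)]
  · rw [hs] at h₁ h₂
    have : s.im = 0 := by nlinarith
    rw [this] at h₁
    norm_num at h₁
  · rw [ht] at h₁ h₂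
    have : t.im = 0 := by nlinarith
    rw [this] at h₁
    norm_num at h₁
  · rw [ht, hs] at h₁
    nlinarith [mul_nonneg ht' hs']

theorem inHalfPlane_or_of_conj_mul {t s : ℂ} (h : (starRingEnd ℂ) t * s = -1) :
    InHalfPlane t ∨ InHalfPlane s := by
  by_contra! hc
  have hneg : ∀ z : ℂ, ¬InHalfPlane z → InHalfPlane (-z) := by
    intro z hz
    simp only [InHalfPlane, not_or, not_and, not_lt, not_le, Complex.neg_re, Complex.neg_im] at *
    rcases hz.1.lt_or_eq with h | h
    · left; linarith
    · exact Or.inr ⟨by linarith, by linarith [hz.2 h]⟩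
  refine not_inHalfPlane_of_conj_mul (t := -t) (s := -s) ?_ (hneg t hc.1) (hneg s hc.2)
  simpa using h

/-- The vectors spanning the rays that the coloring sends to `true`. -/
def Selected (v : Fin 3 → ℂ) : Prop :=
  v 0 ≠ 0 ∧ v 1 * v 2 = 0 ∧ InHalfPlane ((v 1 + v 2) / v 0)

def FullSupport (v : Fin 3 → ℂ) : Prop := ∀ k, v k ≠ 0

theorem conj_div_mul_div {a₀ a₁ b₀ b₁ : ℂ} (ha : a₀ ≠ 0) (hb : b₀ ≠ 0)
    (h : (starRingEnd ℂ) a₀ * b₀ + (starRingEnd ℂ) a₁ * b₁ = 0) :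
    (starRingEnd ℂ) (a₁ / a₀) * (b₁ / b₀) = -1 := by
  have ha' := (map_ne_zero (starRingEnd ℂ)).2 ha
  rw [map_div₀]
  field_simp
  linear_combination h

theorem Selected.not_orthogonal {v w : Fin 3 → ℂ} (hv : Selected v) (hw : Selected w) :
    hermInner v w ≠ 0 := by
  intro h
  rw [hermInner_eq] at h
  obtain ⟨hv0, hv12, hvp⟩ := hv
  obtain ⟨hw0, hw12, hwp⟩ := hw
  have hne : (starRingEnd ℂ) (v 0) * w 0 ≠ 0 := mul_ne_zero ((map_ne_zero _).2 hv0) hw0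
  rcases mul_eq_zero.1 hv12 with h1 | h1 <;> rcases mul_eq_zero.1 hw12 with h2 | h2 <;>
    simp only [h1, h2, map_zero, zero_mul, mul_zero, add_zero, zero_add] at h hvp hwp
  · exact not_inHalfPlane_of_conj_mul (conj_div_mul_div hv0 hw0 h) hvp hwp
  · exact hne h
  · exact hne h
  · exact not_inHalfPlane_of_conj_mul (conj_div_mul_div hv0 hw0 h) hvp hwp

theorem not_coords_eq_zero {v : Fin 3 → ℂ} (hv : v ≠ 0) : ¬(v 0 = 0 ∧ v 1 = 0 ∧ v 2 = 0) := by
  rintro ⟨h0, h1, h2⟩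
  apply hv
  ext k
  fin_cases k <;> assumption

theorem not_fullSupport_iff {v : Fin 3 → ℂ} :
    ¬FullSupport v ↔ v 0 = 0 ∨ v 1 = 0 ∨ v 2 = 0 := by
  simp [FullSupport, Fin.forall_fin_succ]
  tauto

/-- A vector of full support is not part of an orthogonal basis whose other two members have
a vanishing coordinate. -/
theorem not_fullSupport_triple {x y z : Fin 3 → ℂ} (hx : FullSupport x)
    (hy : ¬FullSupport y) (hz : ¬FullSupport z) (hy0 : y ≠ 0) (hz0 : z ≠ 0)
    (hxy : hermInner x y = 0) (hxz : hermInner x z = 0) (hyz : hermInner y z = 0) : False := by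
  have hx0 := hx 0
  have hx1 := hx 1
  have hx2 := hx 2
  have hy' := not_coords_eq_zero hy0
  have hz' := not_coords_eq_zero hz0
  rw [not_fullSupport_iff] at hy hz
  rw [hermInner_eq] at hxy hxz hyz
  rcases hy with hy | hy | hy <;> rcases hz with hz | hz | hz <;>
    simp only [hy, hz, map_zero, zero_mul, mul_zero, add_zero, zero_add, true_and, and_true,
      mul_eq_zero, map_eq_zero] at hxy hxz hyz hy' hz' <;>
    first
    | exact not_pairwise_orthogonal_plane (fun h => hx1 h.1) hy' hz' hxy hxz hyz
    | exact not_pairwise_orthogonal_plane (fun h => hx0 h.1) hy' hz' hxy hxz hyz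
    | (rcases hyz with h | h <;> simp_all)

theorem selected_or_of_support_pair {a b : Fin 3 → ℂ}
    (ha0 : a 0 ≠ 0) (hb0 : b 0 ≠ 0) (ha : ¬FullSupport a) (hb : ¬FullSupport b)
    (hab : hermInner a b = 0) : Selected a ∨ Selected b := by
  rw [not_fullSupport_iff] at ha hb
  rw [hermInner_eq] at hab
  have ha12 : a 1 = 0 ∨ a 2 = 0 := ha.resolve_left ha0
  have hb12 : b 1 = 0 ∨ b 2 = 0 := hb.resolve_left hb0
  have hne : (starRingEnd ℂ) (a 0) * b 0 ≠ 0 := mul_ne_zero ((map_ne_zero _).2 ha0) hb0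
  rcases ha12 with h1 | h1 <;> rcases hb12 with h2 | h2 <;>
    simp only [h1, h2, map_zero, zero_mul, mul_zero, add_zero] at hab
  · simpa [Selected, h1, h2, ha0, hb0] using
      inHalfPlane_or_of_conj_mul (conj_div_mul_div ha0 hb0 hab)
  · exact absurd hab hne
  · exact absurd hab hne
  · simpa [Selected, h1, h2, ha0, hb0] using
      inHalfPlane_or_of_conj_mul (conj_div_mul_div ha0 hb0 hab)

theorem selected_of_not_fullSupport {a b c : Fin 3 → ℂ} (ha0 : a 0 ≠ 0)
    (hb : b ≠ 0) (hc : c ≠ 0) (hfa : ¬FullSupport a) (hfb : ¬FullSupport b)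
    (hfc : ¬FullSupport c) (hab : hermInner a b = 0) (hac : hermInner a c = 0)
    (hbc : hermInner b c = 0) : Selected a ∨ Selected b ∨ Selected c := by
  by_cases hb0 : b 0 = 0
  · by_cases hc0 : c 0 = 0
    · have hb' := not_coords_eq_zero hb
      have hc' := not_coords_eq_zero hc
      rw [hermInner_eq] at hab hac hbc
      simp only [hb0, hc0, map_zero, mul_zero, zero_add, true_and] at hab hac hbc hb' hc'
      by_cases ha' : a 1 = 0 ∧ a 2 = 0
      · left
        simp [Selected, ha'.1, ha'.2, ha0, inHalfPlane_zero]
      · exact (not_pairwise_orthogonal_plane ha' hb' hc' hab hac hbc).elim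
    · have := selected_or_of_support_pair ha0 hc0 hfa hfc hac
      tauto
  · have := selected_or_of_support_pair ha0 hb0 hfa hfb hab
    tauto

theorem exists_selected {a b c : Fin 3 → ℂ} (ha : a ≠ 0) (hb : b ≠ 0) (hc : c ≠ 0)
    (hab : hermInner a b = 0) (hac : hermInner a c = 0) (hbc : hermInner b c = 0)
    (hfab : ¬(FullSupport a ∧ FullSupport b)) (hfac : ¬(FullSupport a ∧ FullSupport c))
    (hfbc : ¬(FullSupport b ∧ FullSupport c)) : Selected a ∨ Selected b ∨ Selected c := by
  have hba := hermInner_symm hab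
  have hca := hermInner_symm hac
  have hcb := hermInner_symm hbc
  have hfa : ¬FullSupport a := fun h => not_fullSupport_triple h (fun h' => hfab ⟨h, h'⟩)
    (fun h' => hfac ⟨h, h'⟩) hb hc hab hac hbc
  have hfb : ¬FullSupport b := fun h => not_fullSupport_triple h hfa
    (fun h' => hfbc ⟨h, h'⟩) ha hc hba hbc hac
  have hfc : ¬FullSupport c := fun h => not_fullSupport_triple h hfa hfb ha hb hca hcb hab
  by_cases ha0 : a 0 = 0
  · by_cases hb0 : b 0 = 0
    · by_cases hc0 : c 0 = 0
      · have ha' := not_coords_eq_zero ha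
        have hb' := not_coords_eq_zero hb
        have hc' := not_coords_eq_zero hc
        rw [hermInner_eq] at hab hac hbc
        simp only [ha0, hb0, hc0, map_zero, mul_zero, zero_add, true_and]
          at hab hac hbc ha' hb' hc'
        exact (not_pairwise_orthogonal_plane ha' hb' hc' hab hac hbc).elim
      · have := selected_of_not_fullSupport hc0 ha hb hfc hfa hfb hca hcb hab
        tauto
    · have := selected_of_not_fullSupport hb0 ha hc hfb hfa hfc hba hbc hac
      tauto
  · exact selected_of_not_fullSupport ha0 hb hc hfa hfb hfc hab hac hbc

theorem conj_eq_inv_of_pow_eq_one {n : ℕ} (hn : n ≠ 0) {u : ℂ} (hu : u ^ n = 1) :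
    (starRingEnd ℂ) u = u⁻¹ :=
  (Complex.inv_eq_conj (Complex.norm_eq_one_of_pow_eq_one hu hn)).symm

theorem one_add_add_ne_zero_of_pow_eq_one {n : ℕ} (hn : n ≠ 0) (h3 : ¬3 ∣ n) {p q : ℂ}
    (hp : p ^ n = 1) (hq : q ^ n = 1) : 1 + p + q ≠ 0 := by
  intro h
  have hp0 : p ≠ 0 := by rintro rfl; simp [hn] at hp
  have hq0 : q ≠ 0 := by rintro rfl; simp [hn] at hq
  have hconj := congrArg (starRingEnd ℂ) h
  simp only [map_add, map_one, map_zero, conj_eq_inv_of_pow_eq_one hn hp,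
    conj_eq_inv_of_pow_eq_one hn hq] at hconj
  field_simp at hconj
  have hpq : p * q = 1 := by linear_combination hconj - h
  have hp3 : p ^ 3 = 1 := by linear_combination (p - 1) * (p * h - hpq)
  have hcop : Nat.Coprime 3 n := (Nat.Prime.coprime_iff_not_dvd Nat.prime_three).2 h3
  have hp1 : p = 1 := by
    have := pow_gcd_eq_one.2 ⟨hp3, hp⟩
    rwa [hcop.gcd_eq_one, pow_one] at this
  subst hp1
  rw [one_mul] at hpq
  subst hpq
  norm_num at h

theorem zeta_pow_self {n : ℕ} (hn : n ≠ 0) : zeta n ^ n = 1 :=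
  (Complex.isPrimitiveRoot_exp n hn).pow_eq_one

theorem rep_of_mem_pool {n : ℕ} (hn : n ≠ 0) {x : Ray3} (hx : x ∈ pool n) :
    ∃ (c : ℂ) (v : Fin 3 → ℂ), c ≠ 0 ∧ x.rep = c • v ∧ ∀ k, v k = 0 ∨ v k ^ n = 1 := by
  obtain ⟨v, hv, rfl, hk⟩ := hx
  obtain ⟨c, hc⟩ := Projectivization.exists_smul_eq_mk_rep ℂ v hv
  refine ⟨c, v, c.ne_zero, hc.symm, fun k => (hk k).imp id ?_⟩
  rintro ⟨j, -, hj⟩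
  rw [hj, ← pow_mul, mul_comm, pow_mul, zeta_pow_self hn, one_pow]

theorem not_fullSupport_of_orthogonal {n : ℕ} (hn : n ≠ 0) (h3 : ¬3 ∣ n) {x y : Ray3}
    (hx : x ∈ pool n) (hy : y ∈ pool n) (hxy : RayOrtho x y) :
    ¬(FullSupport x.rep ∧ FullSupport y.rep) := by
  rintro ⟨hfx, hfy⟩
  obtain ⟨c, v, hc, hxv, hv⟩ := rep_of_mem_pool hn hx
  obtain ⟨d, w, hd, hyw, hw⟩ := rep_of_mem_pool hn hy
  have hv' : ∀ k, v k ^ n = 1 := fun k =>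
    (hv k).resolve_left fun h => hfx k (by simp [hxv, h])
  have hw' : ∀ k, w k ^ n = 1 := fun k =>
    (hw k).resolve_left fun h => hfy k (by simp [hyw, h])
  set u : Fin 3 → ℂ := fun k => (starRingEnd ℂ) (v k) * w k with hu
  have hun : ∀ k, u k ^ n = 1 := fun k => by
    simp only [hu]
    rw [mul_pow, ← map_pow, hv', hw', map_one, one_mul]
  have hsum : u 0 + u 1 + u 2 = 0 := by
    have hcd : (starRingEnd ℂ) c * d ≠ 0 := mul_ne_zero ((map_ne_zero _).2 hc) hd
    apply (mul_eq_zero.1 ?_).resolve_left hcd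
    rw [RayOrtho, hxv, hyw, hermInner_eq] at hxy
    simp only [Pi.smul_apply, smul_eq_mul, map_mul] at hxy
    simp only [hu]
    linear_combination hxy
  have hu0 : u 0 ≠ 0 := by
    intro h
    simpa [h, hn] using hun 0
  refine one_add_add_ne_zero_of_pow_eq_one (p := u 1 / u 0) (q := u 2 / u 0) hn h3
    (by rw [div_pow, hun, hun, div_one]) (by rw [div_pow, hun, hun, div_one]) ?_
  rw [← div_self hu0, ← add_div, ← add_div, hsum, zero_div]

/-- If n is even and 3 ∤ n, the n-th root-of-unity ray pool admits a KS coloring. -/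
theorem stmt10 (n : ℕ) (hn : 1 ≤ n) (heven : 2 ∣ n) (h3 : ¬ 3 ∣ n) :
    ∃ f : Ray3 → Bool, IsKSColoring (pool n) f := by
  classical
  have hn0 : n ≠ 0 := by lia
  refine ⟨fun x => decide (Selected x.rep), ?_, ?_⟩
  · intro v _ w _ hvw hv
    simp only [decide_eq_true_eq, decide_eq_false_iff_not] at hv ⊢
    exact fun hw => hv.not_orthogonal hw hvw
  · intro a ha b hb c hc _ _ _ hab hac hbc
    simp only [decide_eq_true_eq, decide_eq_false_iff_not]
    have hex := exists_selected a.rep_nonzero b.rep_nonzero c.rep_nonzero hab hac hbc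
      (not_fullSupport_of_orthogonal hn0 h3 ha hb hab)
      (not_fullSupport_of_orthogonal hn0 h3 ha hc hac)
      (not_fullSupport_of_orthogonal hn0 h3 hb hc hbc)
    have h₁ : ¬(Selected a.rep ∧ Selected b.rep) := fun h => h.1.not_orthogonal h.2 hab
    have h₂ : ¬(Selected a.rep ∧ Selected c.rep) := fun h => h.1.not_orthogonal h.2 hac
    have h₃ : ¬(Selected b.rep ∧ Selected c.rep) := fun h => h.1.not_orthogonal h.2 hbc
    tauto
end

section
/- If n ≥ 3 is odd and divisible by 3, then every ray of the n-th root-of-unity ray pool P_n belongs to at most one triad of P_n, and the total number of triads of P_n is n²/3 + 1 (namely the axis triad together with n²/3 pairwise disjoint triads of all-nonzero rays). -/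
open Complex

/-- The triads of a set of rays: three-element sets of pairwise orthogonal rays. -/
def TriadsOf (S : Set Ray3) : Set (Set Ray3) :=
  {T | ∃ a b c : Ray3, T = {a, b, c} ∧ a ∈ S ∧ b ∈ S ∧ c ∈ S ∧
    a ≠ b ∧ a ≠ c ∧ b ≠ c ∧ RayOrtho a b ∧ RayOrtho a c ∧ RayOrtho b c}

lemma zeta_isPrimitiveRoot {n : ℕ} (hn : n ≠ 0) : IsPrimitiveRoot (zeta n) n :=
  Complex.isPrimitiveRoot_exp n hn

lemma mem_pool_iff {n : ℕ} (hn : n ≠ 0) (x : Ray3) :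
    x ∈ pool n ↔ ∃ (v : Fin 3 → ℂ) (hv : v ≠ 0), Projectivization.mk ℂ v hv = x ∧
      ∀ k, v k = 0 ∨ v k ^ n = 1 := by
  have hz := zeta_isPrimitiveRoot hn
  have key : ∀ z : ℂ, (∃ j : ℕ, j < n ∧ z = zeta n ^ j) ↔ z ^ n = 1 := by
    intro z
    constructor
    · rintro ⟨j, -, rfl⟩
      rw [← pow_mul, mul_comm, pow_mul, hz.pow_eq_one, one_pow]
    · intro h
      have : NeZero n := ⟨hn⟩
      obtain ⟨j, hj, h⟩ := hz.eq_pow_of_pow_eq_one h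
      exact ⟨j, hj, h.symm⟩
  simp only [pool, Set.mem_ofPred_eq, key]

lemma conj_mul_self_of_pow_eq_one {n : ℕ} (hn : n ≠ 0) {u : ℂ} (hu : u ^ n = 1) :
    (starRingEnd ℂ) u * u = 1 := by
  rw [← Complex.normSq_eq_conj_mul_self, Complex.normSq_eq_norm_sq,
    Complex.norm_eq_one_of_pow_eq_one hu hn]
  simp

lemma rayOrtho_mk_iff {v w : Fin 3 → ℂ} (hv : v ≠ 0) (hw : w ≠ 0) :
    RayOrtho (Projectivization.mk ℂ v hv) (Projectivization.mk ℂ w hw) ↔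
      hermInner v w = 0 := by
  obtain ⟨a, ha⟩ := Projectivization.exists_smul_eq_mk_rep ℂ v hv
  obtain ⟨b, hb⟩ := Projectivization.exists_smul_eq_mk_rep ℂ w hw
  have h : hermInner ((a : ℂ) • v) ((b : ℂ) • w) =
      (starRingEnd ℂ) (a : ℂ) * b * hermInner v w := by
    simp only [hermInner, Fin.sum_univ_three, Pi.smul_apply, smul_eq_mul, map_mul]
    ring
  rw [RayOrtho, ← ha, ← hb, Units.smul_def, Units.smul_def, h]
  simp

/-- Terms that vanish or are roots of unity of odd order cannot cancel in pairs. -/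
lemma all_zero_or_all_ne_zero_of_sum_eq_zero {n : ℕ} (hodd : Odd n) {t : Fin 3 → ℂ}
    (ht : ∀ k, t k = 0 ∨ t k ^ n = 1) (hsum : ∑ k, t k = 0) :
    (∀ k, t k = 0) ∨ ∀ k, t k ≠ 0 := by
  have hn : n ≠ 0 := by rintro rfl; simp at hodd
  have h1 : ∀ a : ℂ, a ^ n = 1 → a ≠ 0 := by
    rintro a ha rfl
    simp [hn] at ha
  have h2 : ∀ a b : ℂ, a ^ n = 1 → b ^ n = 1 → a + b ≠ 0 := by
    intro a b ha hb hab
    rw [eq_neg_of_add_eq_zero_left hab, hodd.neg_pow, hb] at ha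
    norm_num at ha
  rw [Fin.sum_univ_three] at hsum
  simp only [Fin.forall_fin_succ, Fin.isValue, IsEmpty.forall_iff, and_true] at ht ⊢
  simp only [Fin.succ_zero_eq_one, Fin.succ_one_eq_two] at ht ⊢
  obtain ⟨h0 | h0, h1' | h1', h2' | h2'⟩ := ht
  · exact .inl ⟨h0, h1', h2'⟩
  · simp_all
  · simp_all
  · simp only [h0, zero_add] at hsum
    exact absurd hsum (h2 _ _ h1' h2')
  · simp_all
  · simp only [h1', add_zero] at hsum
    exact absurd hsum (h2 _ _ h0 h2')
  · simp only [h2', add_zero] at hsum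
    exact absurd hsum (h2 _ _ h0 h1')
  · exact .inr ⟨h1 _ h0, h1 _ h1', h1 _ h2'⟩

lemma disjoint_or_full_of_hermInner_eq_zero {n : ℕ} (hodd : Odd n) {v w : Fin 3 → ℂ}
    (hv : ∀ k, v k = 0 ∨ v k ^ n = 1) (hw : ∀ k, w k = 0 ∨ w k ^ n = 1)
    (h : hermInner v w = 0) :
    (∀ k, v k = 0 ∨ w k = 0) ∨ ((∀ k, v k ≠ 0) ∧ ∀ k, w k ≠ 0) := by
  have ht : ∀ k, (starRingEnd ℂ) (v k) * w k = 0 ∨ ((starRingEnd ℂ) (v k) * w k) ^ n = 1 := by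
    intro k
    rcases hv k with h1 | h1
    · simp [h1]
    rcases hw k with h2 | h2
    · simp [h2]
    · right
      rw [mul_pow, ← map_pow, h1, h2, map_one, one_mul]
  refine (all_zero_or_all_ne_zero_of_sum_eq_zero hodd ht h).imp ?_ ?_
  · intro H k
    simpa using H k
  · intro H
    have H' : ∀ k, v k ≠ 0 ∧ w k ≠ 0 := fun k => by simpa using H k
    exact ⟨fun k => (H' k).1, fun k => (H' k).2⟩

/-- The ray through `(1, u, w)`. -/
noncomputable def fullRay (u w : ℂ) : Ray3 :=
  Projectivization.mk ℂ ![1, u, w] fun h => one_ne_zero (congrFun h 0)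

/-- The ray of the `k`-th coordinate axis. -/
noncomputable def axisRay (k : Fin 3) : Ray3 :=
  Projectivization.mk ℂ (Pi.single k 1) (by simp)

def axisTriad : Set Ray3 := {axisRay 0, axisRay 1, axisRay 2}

def fullTriad (ω u w : ℂ) : Set Ray3 :=
  {fullRay u w, fullRay (u * ω) (w * ω ^ 2), fullRay (u * ω ^ 2) (w * ω)}

lemma fullRay_inj {u w u' w' : ℂ} : fullRay u w = fullRay u' w' ↔ u = u' ∧ w = w' := by
  constructor
  · intro h
    obtain ⟨a, ha⟩ := (Projectivization.mk_eq_mk_iff' ℂ _ _ _ _).1 h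
    have h0 := congrFun ha 0
    have h1 := congrFun ha 1
    have h2 := congrFun ha 2
    simp at h0 h1 h2
    subst h0
    simp_all
  · rintro ⟨rfl, rfl⟩
    rfl

lemma fullRay_ne_axisRay {u w : ℂ} (hu : u ≠ 0) (k : Fin 3) : fullRay u w ≠ axisRay k := by
  intro h
  obtain ⟨a, ha⟩ := (Projectivization.mk_eq_mk_iff' ℂ _ _ _ _).1 h
  have h0 := congrFun ha 0
  have h1 := congrFun ha 1
  fin_cases k <;> simp_all [eq_comm]

lemma axisRay_injective : Function.Injective axisRay := by
  intro i j h
  obtain ⟨a, ha⟩ := (Projectivization.mk_eq_mk_iff' ℂ _ _ _ _).1 h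
  by_contra hij
  have := congrFun ha i
  simp [hij] at this

lemma mk_eq_fullRay {v : Fin 3 → ℂ} (hv : v ≠ 0) (h0 : v 0 ≠ 0) :
    Projectivization.mk ℂ v hv = fullRay (v 1 / v 0) (v 2 / v 0) := by
  refine (Projectivization.mk_eq_mk_iff' ℂ _ _ _ _).2 ⟨v 0, ?_⟩
  funext k
  fin_cases k <;> simp <;> field_simp

lemma mk_eq_axisRay {v : Fin 3 → ℂ} (hv : v ≠ 0) {k : Fin 3} (h : ∀ j, j ≠ k → v j = 0) :
    Projectivization.mk ℂ v hv = axisRay k := by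
  refine (Projectivization.mk_eq_mk_iff' ℂ _ _ _ _).2 ⟨v k, ?_⟩
  funext j
  by_cases hj : j = k
  · subst hj; simp
  · simp [hj, h j hj]

lemma fullRay_mem_pool {n : ℕ} (hn : n ≠ 0) {u w : ℂ} (hu : u ^ n = 1) (hw : w ^ n = 1) :
    fullRay u w ∈ pool n := by
  refine (mem_pool_iff hn _).2 ⟨_, _, rfl, fun k => ?_⟩
  fin_cases k <;> simp [hu, hw]

lemma axisRay_mem_pool {n : ℕ} (hn : n ≠ 0) (k : Fin 3) : axisRay k ∈ pool n := by
  refine (mem_pool_iff hn _).2 ⟨_, _, rfl, fun j => ?_⟩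
  by_cases hj : j = k
  · subst hj; simp
  · simp [hj]

lemma rayOrtho_axisRay {i j : Fin 3} (h : i ≠ j) : RayOrtho (axisRay i) (axisRay j) := by
  refine (rayOrtho_mk_iff _ _).2 ?_
  refine Finset.sum_eq_zero fun k _ => ?_
  by_cases hk : k = i
  · subst hk; simp [h]
  · simp [hk]

lemma rayOrtho_fullRay_iff {u w u' w' : ℂ} : RayOrtho (fullRay u w) (fullRay u' w') ↔
    1 + (starRingEnd ℂ) u * u' + (starRingEnd ℂ) w * w' = 0 := by
  refine (rayOrtho_mk_iff _ _).trans ?_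
  simp [hermInner, Fin.sum_univ_three]

lemma axisTriad_mem {n : ℕ} (hn : n ≠ 0) : axisTriad ∈ TriadsOf (pool n) :=
  ⟨_, _, _, rfl, axisRay_mem_pool hn _, axisRay_mem_pool hn _, axisRay_mem_pool hn _,
    axisRay_injective.ne (by decide), axisRay_injective.ne (by decide),
    axisRay_injective.ne (by decide), rayOrtho_axisRay (by decide),
    rayOrtho_axisRay (by decide), rayOrtho_axisRay (by decide)⟩

lemma cube_eq_one {ω : ℂ} (hω : ω ^ 2 + ω + 1 = 0) : ω ^ 3 = 1 := by
  linear_combination (ω - 1) * hω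

lemma cubeRoot_ne_one {ω : ℂ} (hω : ω ^ 2 + ω + 1 = 0) : ω ≠ 1 := by
  rintro rfl
  norm_num at hω

lemma cubeRoot_sq_ne_one {ω : ℂ} (hω : ω ^ 2 + ω + 1 = 0) : ω ^ 2 ≠ 1 := by
  intro h
  refine cubeRoot_ne_one hω ?_
  linear_combination cube_eq_one hω - ω * h

/-- The rays `(1, u', w')` orthogonal to a ray `(1, u, w)`, all entries being unimodular. -/
lemma eq_or_eq_of_rayOrtho_fullRay {n : ℕ} (hn : n ≠ 0) {ω : ℂ} (hω : ω ^ 2 + ω + 1 = 0)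
    {u w u' w' : ℂ} (hu : u ^ n = 1) (hw : w ^ n = 1) (hu' : u' ^ n = 1) (hw' : w' ^ n = 1)
    (h : RayOrtho (fullRay u w) (fullRay u' w')) :
    (u' = u * ω ∧ w' = w * ω ^ 2) ∨ (u' = u * ω ^ 2 ∧ w' = w * ω) := by
  rw [rayOrtho_fullRay_iff] at h
  have hc := congrArg (starRingEnd ℂ) h
  simp only [map_add, map_mul, map_one, map_zero, Complex.conj_conj] at hc
  have cu := conj_mul_self_of_pow_eq_one hn hu
  have cw := conj_mul_self_of_pow_eq_one hn hw
  have cu' := conj_mul_self_of_pow_eq_one hn hu'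
  have cw' := conj_mul_self_of_pow_eq_one hn hw'
  obtain ⟨x, hx⟩ : ∃ x, x = (starRingEnd ℂ) u * u' := ⟨_, rfl⟩
  obtain ⟨y, hy⟩ : ∃ y, y = (starRingEnd ℂ) w * w' := ⟨_, rfl⟩
  obtain ⟨x', hx'⟩ : ∃ x', x' = u * (starRingEnd ℂ) u' := ⟨_, rfl⟩
  obtain ⟨y', hy'⟩ : ∃ y', y' = w * (starRingEnd ℂ) w' := ⟨_, rfl⟩
  have e1 : x * x' = 1 := by
    rw [hx, hx']; linear_combination cu' * ((starRingEnd ℂ) u * u) + cu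
  have e2 : y * y' = 1 := by
    rw [hy, hy']; linear_combination cw' * ((starRingEnd ℂ) w * w) + cw
  rw [← hx, ← hy] at h
  rw [← hx', ← hy'] at hc
  have hu1 : u' = u * x := by rw [hx]; linear_combination -u' * cu
  have hw1 : w' = w * y := by rw [hy]; linear_combination -w' * cw
  have hxy : x * y = 1 := by linear_combination x * y * hc - y * e1 - x * e2 - h
  have hq : (x - ω) * (x - ω ^ 2) = 0 := by
    linear_combination x * h - hxy - x * hω + cube_eq_one hω
  rcases mul_eq_zero.1 hq with hq | hq
  · left
    rw [hu1, hw1]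
    refine ⟨by linear_combination u * hq, ?_⟩
    linear_combination w * h - w * hω - w * hq
  · right
    rw [hu1, hw1]
    refine ⟨by linear_combination u * hq, ?_⟩
    linear_combination w * h - w * hω - w * hq

lemma fullTriad_mem {n : ℕ} (hn : n ≠ 0) {ω : ℂ} (hω : ω ^ 2 + ω + 1 = 0) (hωn : ω ^ n = 1)
    {u w : ℂ} (hu : u ^ n = 1) (hw : w ^ n = 1) : fullTriad ω u w ∈ TriadsOf (pool n) := by
  have hω2 : (ω ^ 2) ^ n = 1 := by rw [← pow_mul, mul_comm, pow_mul, hωn, one_pow]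
  have hu0 : u ≠ 0 := by rintro rfl; simp [hn] at hu
  have hω0 : ω ≠ 0 := by rintro rfl; simp at hω
  have h1 := cubeRoot_ne_one hω
  have h2 := cubeRoot_sq_ne_one hω
  have h3 := cube_eq_one hω
  have cu := conj_mul_self_of_pow_eq_one hn hu
  have cw := conj_mul_self_of_pow_eq_one hn hw
  have cω := conj_mul_self_of_pow_eq_one hn hωn
  have cω2 : (starRingEnd ℂ) ω = ω ^ 2 := by
    linear_combination ω ^ 2 * cω - (starRingEnd ℂ) ω * h3
  refine ⟨_, _, _, rfl, fullRay_mem_pool hn hu hw,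
    fullRay_mem_pool hn (by rw [mul_pow, hu, hωn, one_mul]) (by rw [mul_pow, hw, hω2, one_mul]),
    fullRay_mem_pool hn (by rw [mul_pow, hu, hω2, one_mul]) (by rw [mul_pow, hw, hωn, one_mul]),
    ?_, ?_, ?_, ?_, ?_, ?_⟩
  · rw [Ne, fullRay_inj]
    rintro ⟨h, -⟩
    exact h1 (mul_left_cancel₀ hu0 (by linear_combination -h))
  · rw [Ne, fullRay_inj]
    rintro ⟨h, -⟩
    exact h2 (mul_left_cancel₀ hu0 (by linear_combination -h))
  · rw [Ne, fullRay_inj]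
    rintro ⟨h, -⟩
    exact h1 (mul_left_cancel₀ (mul_ne_zero hu0 hω0) (by linear_combination -h))
  · rw [rayOrtho_fullRay_iff]
    linear_combination hω + ω * cu + ω ^ 2 * cw
  · rw [rayOrtho_fullRay_iff]
    linear_combination hω + ω ^ 2 * cu + ω * cw
  · rw [rayOrtho_fullRay_iff]
    simp only [map_mul, map_pow, cω2]
    linear_combination hω + ω ^ 4 * cu + ω ^ 5 * cw + (ω + ω ^ 2) * h3

lemma axisTriad_eq_of_ne {i j k : Fin 3} (hij : i ≠ j) (hik : i ≠ k) (hjk : j ≠ k) :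
    ({axisRay i, axisRay j, axisRay k} : Set Ray3) = axisTriad := by
  have h : ({i, j, k} : Set (Fin 3)) = {0, 1, 2} := by
    ext l
    simp only [Set.mem_insert_iff, Set.mem_singleton_iff]
    lia
  simpa [Set.image_insert_eq, axisTriad] using congrArg (axisRay '' ·) h

lemma triad_eq_axisTriad {va vb vc : Fin 3 → ℂ} (ha : va ≠ 0) (hb : vb ≠ 0) (hc : vc ≠ 0)
    (hab : ∀ k, va k = 0 ∨ vb k = 0) (hac : ∀ k, va k = 0 ∨ vc k = 0)
    (hbc : ∀ k, vb k = 0 ∨ vc k = 0) :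
    ({Projectivization.mk ℂ va ha, Projectivization.mk ℂ vb hb,
      Projectivization.mk ℂ vc hc} : Set Ray3) = axisTriad := by
  obtain ⟨i, hi⟩ := Function.ne_iff.1 ha
  obtain ⟨j, hj⟩ := Function.ne_iff.1 hb
  obtain ⟨k, hk⟩ := Function.ne_iff.1 hc
  simp only [Pi.zero_apply] at hi hj hk
  have hij : i ≠ j := by rintro rfl; exact (hab i).elim hi hj
  have hik : i ≠ k := by rintro rfl; exact (hac i).elim hi hk
  have hjk : j ≠ k := by rintro rfl; exact (hbc j).elim hj hk
  have hcover : ∀ l, l = i ∨ l = j ∨ l = k := by lia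
  rw [mk_eq_axisRay ha (k := i), mk_eq_axisRay hb (k := j), mk_eq_axisRay hc (k := k),
    axisTriad_eq_of_ne hij hik hjk]
  · intro l hl
    rcases hcover l with rfl | rfl | rfl
    · exact (hac l).resolve_left hi
    · exact (hbc l).resolve_left hj
    · exact absurd rfl hl
  · intro l hl
    rcases hcover l with rfl | rfl | rfl
    · exact (hab l).resolve_left hi
    · exact absurd rfl hl
    · exact (hbc l).resolve_right hk
  · intro l hl
    rcases hcover l with rfl | rfl | rfl
    · exact absurd rfl hl
    · exact (hab l).resolve_right hj
    · exact (hac l).resolve_right hk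

lemma exists_eq_fullRay {n : ℕ} {v : Fin 3 → ℂ} (hv : v ≠ 0)
    (hp : ∀ k, v k = 0 ∨ v k ^ n = 1) (hne : ∀ k, v k ≠ 0) :
    ∃ u w : ℂ, u ^ n = 1 ∧ w ^ n = 1 ∧ Projectivization.mk ℂ v hv = fullRay u w := by
  have hp' : ∀ k, v k ^ n = 1 := fun k => (hp k).resolve_left (hne k)
  exact ⟨_, _, by rw [div_pow, hp', hp', div_one], by rw [div_pow, hp', hp', div_one],
    mk_eq_fullRay hv (hne 0)⟩

lemma mem_triadsOf_pool_iff {n : ℕ} (hodd : Odd n) {ω : ℂ} (hω : ω ^ 2 + ω + 1 = 0)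
    (hωn : ω ^ n = 1) (T : Set Ray3) :
    T ∈ TriadsOf (pool n) ↔
      T = axisTriad ∨ ∃ u w : ℂ, u ^ n = 1 ∧ w ^ n = 1 ∧ T = fullTriad ω u w := by
  have hn : n ≠ 0 := by rintro rfl; simp at hodd
  constructor
  · rintro ⟨a, b, c, rfl, ha, hb, hc, hab, hac, hbc, oab, oac, obc⟩
    obtain ⟨va, hva, rfl, pa⟩ := (mem_pool_iff hn a).1 ha
    obtain ⟨vb, hvb, rfl, pb⟩ := (mem_pool_iff hn b).1 hb
    obtain ⟨vc, hvc, rfl, pc⟩ := (mem_pool_iff hn c).1 hc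
    have dab := disjoint_or_full_of_hermInner_eq_zero hodd pa pb ((rayOrtho_mk_iff _ _).1 oab)
    have dac := disjoint_or_full_of_hermInner_eq_zero hodd pa pc ((rayOrtho_mk_iff _ _).1 oac)
    have dbc := disjoint_or_full_of_hermInner_eq_zero hodd pb pc ((rayOrtho_mk_iff _ _).1 obc)
    by_cases hfull : ∀ k, va k ≠ 0
    · right
      have fb : ∀ k, vb k ≠ 0 := by
        rcases dab with h | h
        · exact absurd (funext fun k => (h k).resolve_left (hfull k)) hvb
        · exact h.2
      have fc : ∀ k, vc k ≠ 0 := by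
        rcases dac with h | h
        · exact absurd (funext fun k => (h k).resolve_left (hfull k)) hvc
        · exact h.2
      obtain ⟨u, w, hu, hw, ea⟩ := exists_eq_fullRay hva pa hfull
      obtain ⟨ub, wb, hub, hwb, eb⟩ := exists_eq_fullRay hvb pb fb
      obtain ⟨uc, wc, huc, hwc, ec⟩ := exists_eq_fullRay hvc pc fc
      rw [ea, eb] at oab
      rw [ea, ec] at oac
      rw [eb, ec] at hbc
      refine ⟨u, w, hu, hw, ?_⟩
      rw [ea, eb, ec, fullTriad]
      rcases eq_or_eq_of_rayOrtho_fullRay hn hω hu hw hub hwb oab with ⟨rfl, rfl⟩ | ⟨rfl, rfl⟩ <;>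
      rcases eq_or_eq_of_rayOrtho_fullRay hn hω hu hw huc hwc oac with ⟨rfl, rfl⟩ | ⟨rfl, rfl⟩
      · exact absurd rfl hbc
      · rfl
      · rw [Set.pair_comm (fullRay (u * ω ^ 2) _)]
      · exact absurd rfl hbc
    · left
      have dab' := dab.resolve_right fun h => hfull h.1
      have dac' := dac.resolve_right fun h => hfull h.1
      refine triad_eq_axisTriad hva hvb hvc dab' dac' (dbc.resolve_right fun h => ?_)
      exact hva (funext fun k => (dab' k).resolve_right (h.1 k))
  · rintro (rfl | ⟨u, w, hu, hw, rfl⟩)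
    · exact axisTriad_mem hn
    · exact fullTriad_mem hn hω hωn hu hw

lemma fullRay_mem_fullTriad_iff {ω p q u w : ℂ} : fullRay p q ∈ fullTriad ω u w ↔
    (p = u ∧ q = w) ∨ (p = u * ω ∧ q = w * ω ^ 2) ∨ (p = u * ω ^ 2 ∧ q = w * ω) := by
  simp [fullTriad, fullRay_inj]

lemma fullTriad_eq_of_mem {ω : ℂ} (hω : ω ^ 2 + ω + 1 = 0) {p q u w : ℂ}
    (h : fullRay p q ∈ fullTriad ω u w) : fullTriad ω u w = fullTriad ω p q := by
  have h3 := cube_eq_one hω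
  have h4 : ω ^ 4 = ω := by linear_combination ω * h3
  rcases fullRay_mem_fullTriad_iff.1 h with ⟨rfl, rfl⟩ | ⟨rfl, rfl⟩ | ⟨rfl, rfl⟩
  · rfl
  · have e1 : u * ω * ω = u * ω ^ 2 := by ring
    have e2 : w * ω ^ 2 * ω ^ 2 = w * ω := by linear_combination w * h4
    have e3 : u * ω * ω ^ 2 = u := by linear_combination u * h3
    have e4 : w * ω ^ 2 * ω = w := by linear_combination w * h3
    simp only [fullTriad, e1, e2, e3, e4]
    grind
  · have e1 : u * ω ^ 2 * ω = u := by linear_combination u * h3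
    have e2 : w * ω * ω ^ 2 = w := by linear_combination w * h3
    have e3 : u * ω ^ 2 * ω ^ 2 = u * ω := by linear_combination u * h4
    have e4 : w * ω * ω = w * ω ^ 2 := by ring
    simp only [fullTriad, e1, e2, e3, e4]
    grind

lemma exists_eq_fullRay_of_mem_fullTriad {n : ℕ} {ω u w : ℂ} {x : Ray3} (hωn : ω ^ n = 1)
    (hu : u ^ n = 1) (h : x ∈ fullTriad ω u w) :
    ∃ p q : ℂ, p ^ n = 1 ∧ x = fullRay p q := by
  have hω2 : (ω ^ 2) ^ n = 1 := by rw [← pow_mul, mul_comm, pow_mul, hωn, one_pow]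
  rcases h with rfl | rfl | rfl
  · exact ⟨_, _, hu, rfl⟩
  · exact ⟨_, _, by rw [mul_pow, hu, hωn, one_mul], rfl⟩
  · exact ⟨_, _, by rw [mul_pow, hu, hω2, one_mul], rfl⟩

lemma disjoint_axisTriad_fullTriad {n : ℕ} (hn : n ≠ 0) {ω u w : ℂ} (hωn : ω ^ n = 1)
    (hu : u ^ n = 1) : Disjoint axisTriad (fullTriad ω u w) := by
  rw [Set.disjoint_left]
  intro x hx hx'
  obtain ⟨p, q, hp, rfl⟩ := exists_eq_fullRay_of_mem_fullTriad hωn hu hx'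
  have hp0 : p ≠ 0 := by rintro rfl; simp [hn] at hp
  rcases hx with h | h | h <;> exact fullRay_ne_axisRay hp0 _ h

/-- Every triad of all-nonzero rays has exactly one member `(1, ζ ^ i, ζ ^ j)` with `i < n / 3`. -/
lemma triadsOf_pool_eq {m : ℕ} (hodd : Odd (3 * m)) {ζ : ℂ} (hζ : IsPrimitiveRoot ζ (3 * m))
    (hω : (ζ ^ m) ^ 2 + ζ ^ m + 1 = 0) :
    TriadsOf (pool (3 * m)) = insert axisTriad
      ((fun p : ℕ × ℕ => fullTriad (ζ ^ m) (ζ ^ p.1) (ζ ^ p.2)) ''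
        (Finset.range m ×ˢ Finset.range (3 * m) : Finset (ℕ × ℕ))) := by
  have hn : 3 * m ≠ 0 := by intro h; simp [h] at hodd
  have : NeZero (3 * m) := ⟨hn⟩
  have hpow : ∀ i, (ζ ^ i) ^ (3 * m) = 1 := fun i => by
    rw [← pow_mul, mul_comm, pow_mul, hζ.pow_eq_one, one_pow]
  ext T
  rw [mem_triadsOf_pool_iff hodd hω (hpow m), Set.mem_insert_iff]
  refine or_congr_right ⟨?_, ?_⟩
  · rintro ⟨u, w, hu, hw, rfl⟩
    obtain ⟨i, hi, rfl⟩ := hζ.eq_pow_of_pow_eq_one hu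
    have hm : 0 < m := by lia
    obtain ⟨j, hj, hjw⟩ := hζ.eq_pow_of_pow_eq_one (ξ := w * (ζ ^ m) ^ (i / m))
      (by rw [mul_pow, hw, one_mul, ← pow_mul ζ m, hpow])
    refine ⟨(i % m, j), by simp [Nat.mod_lt i hm, hj], ?_⟩
    refine (fullTriad_eq_of_mem hω ?_).symm
    have hq : i / m < 3 := Nat.div_lt_of_lt_mul (by lia)
    have h3 := cube_eq_one hω
    have hi : ζ ^ i = ζ ^ (i % m) * (ζ ^ m) ^ (i / m) := by
      rw [← pow_mul, ← pow_add, Nat.mod_add_div]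
    rw [fullRay_mem_fullTriad_iff, hi, hjw]
    generalize i / m = q at *
    interval_cases q
    · left; simp
    · right; right
      exact ⟨by linear_combination -ζ ^ (i % m) * h3, by ring⟩
    · right; left
      exact ⟨by linear_combination -ζ ^ (i % m) * h3, by ring⟩
  · rintro ⟨p, -, rfl⟩
    exact ⟨_, _, hpow _, hpow _, rfl⟩

lemma injOn_fullTriad {m : ℕ} {ζ : ℂ} (hζ : IsPrimitiveRoot ζ (3 * m)) :
    Set.InjOn (fun p : ℕ × ℕ => fullTriad (ζ ^ m) (ζ ^ p.1) (ζ ^ p.2))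
      (Finset.range m ×ˢ Finset.range (3 * m) : Finset (ℕ × ℕ)) := by
  rintro ⟨i, j⟩ hij ⟨i', j'⟩ hij' h
  simp only [Finset.coe_product, Finset.coe_range, Set.mem_prod, Set.mem_Iio] at hij hij' h
  have hmem : fullRay (ζ ^ i) (ζ ^ j) ∈ fullTriad (ζ ^ m) (ζ ^ i') (ζ ^ j') :=
    h ▸ fullRay_mem_fullTriad_iff.2 (.inl ⟨rfl, rfl⟩)
  rcases fullRay_mem_fullTriad_iff.1 hmem with ⟨h1, h2⟩ | ⟨h1, -⟩ | ⟨h1, -⟩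
  · rw [hζ.pow_inj (by lia) (by lia) h1, hζ.pow_inj (by lia) (by lia) h2]
  · rw [← pow_add] at h1
    have := hζ.pow_inj (by lia) (by lia) h1
    lia
  · rw [← pow_mul, ← pow_add] at h1
    have := hζ.pow_inj (by lia) (by lia) h1
    lia

/-- For odd n ≥ 3 divisible by 3: every ray lies in at most one triad of the
pool, and the total number of triads is n²/3 + 1. -/
theorem stmt12 (n : ℕ) (hn : 3 ≤ n) (hodd : Odd n) (h3 : 3 ∣ n) :
    (∀ T₁ ∈ TriadsOf (pool n), ∀ T₂ ∈ TriadsOf (pool n),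
      ∀ x : Ray3, x ∈ T₁ → x ∈ T₂ → T₁ = T₂) ∧
    (TriadsOf (pool n)).ncard = n ^ 2 / 3 + 1 := by
  obtain ⟨m, rfl⟩ := h3
  have hn0 : 3 * m ≠ 0 := by lia
  have hζ := zeta_isPrimitiveRoot hn0
  generalize zeta (3 * m) = ζ at hζ
  have hω3 : IsPrimitiveRoot (ζ ^ m) 3 := hζ.pow (by lia) (mul_comm 3 m)
  have hω : (ζ ^ m) ^ 2 + ζ ^ m + 1 = 0 := by
    have := hω3.geom_sum_eq_zero (by norm_num)
    simp only [Finset.sum_range_succ, Finset.sum_range_zero] at this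
    linear_combination this
  have hωn : (ζ ^ m) ^ (3 * m) = 1 := by rw [pow_mul, hω3.pow_eq_one, one_pow]
  refine ⟨?_, ?_⟩
  · intro T₁ hT₁ T₂ hT₂ x hx₁ hx₂
    rw [mem_triadsOf_pool_iff hodd hω hωn] at hT₁ hT₂
    rcases hT₁ with rfl | ⟨u, w, hu, hw, rfl⟩ <;> rcases hT₂ with rfl | ⟨u', w', hu', hw', rfl⟩
    · rfl
    · exact absurd hx₂ (Set.disjoint_left.1 (disjoint_axisTriad_fullTriad hn0 hωn hu') hx₁)
    · exact absurd hx₁ (Set.disjoint_left.1 (disjoint_axisTriad_fullTriad hn0 hωn hu) hx₂)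
    · obtain ⟨p, q, -, rfl⟩ := exists_eq_fullRay_of_mem_fullTriad hωn hu hx₁
      rw [fullTriad_eq_of_mem hω hx₁, fullTriad_eq_of_mem hω hx₂]
  · rw [triadsOf_pool_eq hodd hζ hω, Set.ncard_insert_of_notMem,
      (injOn_fullTriad hζ).ncard_image, Set.ncard_coe_finset, Finset.card_product,
      Finset.card_range, Finset.card_range]
    · have : (3 * m) ^ 2 = 3 * (m * (3 * m)) := by ring
      rw [this, Nat.mul_div_cancel_left _ (by norm_num)]
    · rintro ⟨p, -, hp⟩
      have hd := disjoint_axisTriad_fullTriad hn0 (w := ζ ^ p.2) hωn (u := ζ ^ p.1)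
        (by rw [← pow_mul, mul_comm, pow_mul, hζ.pow_eq_one, one_pow])
      refine Set.disjoint_left.1 hd (.inl rfl) (hp.symm.subset ?_)
      exact .inl rfl
end
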